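/- For every f ∈ H, there exists a unique F_f ∈ A_1^1 such that the rooted tree map satisfies f̃(z_s^δ w) = z_s^δ (F_f ⋄_s w) for all s ∈ μ_r and all w ∈ A_r. Explicitly, F_f is given recursively by F_𝟙 = 1, F_• = y, F_{B_+(g)} = R_y R_{x+2y} R_y^{-1}(F_g) for g ≠ 𝟙, and F_{gh} = F_g ⋄_1 F_h. -/

import Mathlib

open FreeAlgebra

/-- Alphabet of `A_1 = ℚ⟨x,y⟩`. -/
inductive LetA : Type | x : LetA | y : LetA

/-- Alphabet of `A_r = ℚ⟨x, y_s : s ∈ μ_r⟩`; the group `G` plays the role of `μ_r`. -/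
inductive LetR (G : Type) : Type | x : LetR G | y : G → LetR G

/-- `A_1 = ℚ⟨x, y⟩`. -/
abbrev A1 : Type := FreeAlgebra ℚ LetA

/-- `A_r = ℚ⟨x, y_s : s ∈ μ_r⟩`. -/
abbrev Ar (G : Type) : Type := FreeAlgebra ℚ (LetR G)

noncomputable def X1 : A1 := ι ℚ LetA.x
noncomputable def Y1 : A1 := ι ℚ LetA.y

variable {G : Type} [CommGroup G]

noncomputable def Xr : Ar G := ι ℚ LetR.x
noncomputable def Yr (s : G) : Ar G := ι ℚ (LetR.y s)

/-- `z = x + y_1`. -/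
noncomputable def zet : Ar G := Xr + Yr 1

open scoped Classical in
/-- `z_s^δ = x + δ(s) y_s` with `δ(1) = 0`, `δ(s) = 1` otherwise. -/
noncomputable def zdel (s : G) : Ar G := if s = 1 then Xr else Xr + Yr s

/-- The involutive automorphism `φ` of `A_r`: `φ(x) = z`, `φ(y_s) = z_s^δ - z`. -/
noncomputable def phi : Ar G →ₐ[ℚ] Ar G :=
  lift ℚ (fun l => match l with
    | LetR.x => zet
    | LetR.y s => zdel s - zet)

/-- The natural embedding `A_1 → A_r`, `x ↦ x`, `y ↦ y_1`. -/
noncomputable def jm : A1 →ₐ[ℚ] Ar G :=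
  lift ℚ (fun l => match l with
    | LetA.x => Xr
    | LetA.y => Yr 1)

open scoped Classical in
/-- The anti-automorphism `τ` of `A_r`: `τ(x) = y_1`, `τ(y_1) = x`, `τ(y_s) = -y_s` (`s ≠ 1`). -/
noncomputable def tauR : Ar G →ₗ[ℚ] Ar G :=
  (MulOpposite.opLinearEquiv ℚ).symm.toLinearMap ∘ₗ
    (lift ℚ (fun l => match l with
      | LetR.x => MulOpposite.op (Yr 1)
      | LetR.y s => MulOpposite.op (if s = 1 then Xr else -(Yr s)) ) :
        Ar G →ₐ[ℚ] (Ar G)ᵐᵒᵖ).toLinearMap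

/-- The anti-automorphism `τ` of `A_1`: `τ(x) = y`, `τ(y) = x`. -/
noncomputable def tau1 : A1 →ₗ[ℚ] A1 :=
  (MulOpposite.opLinearEquiv ℚ).symm.toLinearMap ∘ₗ
    (lift ℚ (fun l => match l with
      | LetA.x => MulOpposite.op Y1
      | LetA.y => MulOpposite.op X1) : A1 →ₐ[ℚ] A1ᵐᵒᵖ).toLinearMap

/-- `wordP [(a₁,s₁),...,(a_l,s_l)] = x^{a₁} y_{s₁} ⋯ x^{a_l} y_{s_l}`,
i.e. the word `z_{a₁+1, s₁} ⋯ z_{a_l+1, s_l}`. -/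
noncomputable def wordP (L : List (ℕ × G)) : Ar G :=
  (L.map (fun p => Xr ^ p.1 * Yr p.2)).prod

/-- Cumulative-product reindexing of subscripts: this realizes the composition `I ∘ M_s`
on subscript lists, sending `(s₁, s₂, …, s_l)` to `(s s₁, s s₁ s₂, …, s s₁ ⋯ s_l)`. -/
def cumul : G → List (ℕ × G) → List (ℕ × G)
  | _, [] => []
  | g, p :: L => (p.1, g * p.2) :: cumul (g * p.2) L

/-- All the data entering the definition of the diamond products `⋄_s`:
the harmonic product `*`, the maps `ψ_s = φ ∘ I ∘ M_s`, and the family of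
`ℚ`-bilinear diamond products `D s : A_1 × A_r → A_r` (together with the
corestriction `D1` of `⋄_1` to `A_1 × A_1 → A_1`), each characterized by its
defining recursive rules. -/
structure DiamondSetup (G : Type) [CommGroup G] where
  /-- the harmonic product -/
  hst : Ar G →ₗ[ℚ] Ar G →ₗ[ℚ] Ar G
  one_hst : ∀ w, hst 1 w = w
  hst_one : ∀ v, hst v 1 = v
  hst_xr : ∀ v w, hst (v * Xr) w = hst v w * Xr
  hst_xl : ∀ v w, hst v (w * Xr) = hst v w * Xr
  hst_yy : ∀ (v w : Ar G) (s t : G), hst (v * Yr s) (w * Yr t) =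
      hst v (w * Yr t) * Yr s + hst (v * Yr s) w * Yr t + hst v w * (Xr * Yr (s * t))
  /-- the linear automorphisms `ψ_s = φ ∘ I ∘ M_s` -/
  psi : G → (Ar G ≃ₗ[ℚ] Ar G)
  psi_spec : ∀ (s : G) (L : List (ℕ × G)) (a : ℕ),
      psi s (wordP L * Xr ^ a) = phi (wordP (cumul s L) * Xr ^ a)
  /-- the diamond products `⋄_s : A_1 × A_r → A_r` -/
  D : G → A1 →ₗ[ℚ] Ar G →ₗ[ℚ] Ar G
  one_D : ∀ (s : G) (w : Ar G), D s 1 w = w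
  D_one : ∀ (s : G) (v : A1), D s v 1 = psi s (phi (jm v))
  Dxx : ∀ (s : G) (v : A1) (w : Ar G), D s (v * X1) (w * Xr) =
      D s v (w * Xr) * Xr - D s (v * Y1) w * Xr
  Dyx : ∀ (s : G) (v : A1) (w : Ar G), D s (v * Y1) (w * Xr) =
      D s v (w * Xr) * Yr 1 + D s (v * Y1) w * Xr
  Dxy : ∀ (s : G) (v : A1) (w : Ar G), D s (v * X1) (w * Yr 1) =
      D s v (w * Yr 1) * Xr + D s (v * X1) w * Yr 1
  Dyy : ∀ (s : G) (v : A1) (w : Ar G), D s (v * Y1) (w * Yr 1) =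
      D s v (w * Yr 1) * Yr 1 - D s (v * X1) w * Yr 1
  Dxyt : ∀ (s t : G), t ≠ 1 → ∀ (v : A1) (w : Ar G), D s (v * X1) (w * Yr t) =
      D s v (w * Yr t) * Xr + D s v (w * (Xr + Yr t)) * Yr t - D s (v * Y1) w * Yr t
  Dyyt : ∀ (s t : G), t ≠ 1 → ∀ (v : A1) (w : Ar G), D s (v * Y1) (w * Yr t) =
      D s v (w * Yr t) * Yr 1 - D s v (w * (Xr + Yr t)) * Yr t + D s (v * Y1) w * Yr t
  /-- `⋄_1` as a product `A_1 × A_1 → A_1` -/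
  D1 : A1 →ₗ[ℚ] A1 →ₗ[ℚ] A1
  D1_spec : ∀ u v : A1, jm (D1 u v) = D 1 u (jm v)

open TensorProduct in
/-- Evaluation of a family of endomorphisms at a fixed element, as a linear map. -/
noncomputable def evalT {G : Type} [CommGroup G] {H : Type} [CommRing H] [HopfAlgebra ℚ H]
    (T : H →ₐ[ℚ] Module.End ℚ (Ar G)) (w : Ar G) : H →ₗ[ℚ] Ar G :=
  (LinearMap.applyₗ w).comp T.toLinearMap

open TensorProduct in
/-- The linear map `H ⊗ H → A_r` induced by the bilinear map `(a, b) ↦ (T a)(w) ⋅ (T b)(v)`. -/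
noncomputable def Tpair {G : Type} [CommGroup G] {H : Type} [CommRing H] [HopfAlgebra ℚ H]
    (T : H →ₐ[ℚ] Module.End ℚ (Ar G)) (w v : Ar G) : H ⊗[ℚ] H →ₗ[ℚ] Ar G :=
  TensorProduct.lift (((LinearMap.mul ℚ (Ar G)).compl₂ (evalT T v)).comp (evalT T w))

open TensorProduct in
/-- The Connes–Kreimer Hopf algebra of rooted forests `H` together with the grafting
operator `B_+`, the rooted tree maps `f ↦ f̃`, and the polynomials `F_f`, `G_f ∈ A_1`,
each characterized by its defining properties. -/
structure CKSetup (G : Type) [CommGroup G] (H : Type) [CommRing H] [HopfAlgebra ℚ H] where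
  /-- the diamond/harmonic data on `A_1`, `A_r` -/
  ds : DiamondSetup G
  /-- the grafting operator `B_+` -/
  Bp : H →ₗ[ℚ] H
  /-- the Hochschild 1-cocycle property `Δ(B_+(f)) = B_+(f) ⊗ 𝟙 + (id ⊗ B_+)(Δ f)` -/
  Bp_cocycle : ∀ f : H, Coalgebra.comul (R := ℚ) (Bp f) =
      (Bp f) ⊗ₜ[ℚ] (1 : H) + (TensorProduct.map LinearMap.id Bp) (Coalgebra.comul (R := ℚ) f)
  /-- `H` is generated by rooted forests: it is the smallest subspace containing `1` and
  closed under multiplication and `B_+`. -/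
  hgen : ∀ P : Submodule ℚ H, (1 : H) ∈ P → (∀ a b : H, a ∈ P → b ∈ P → a * b ∈ P) →
      (∀ a ∈ P, Bp a ∈ P) → ∀ h : H, h ∈ P
  /-- the rooted tree maps `f ↦ f̃`, an algebra homomorphism `H → End(A_r)` -/
  T : H →ₐ[ℚ] Module.End ℚ (Ar G)
  /-- rule (I): `•̃(z_s^δ) = z_s^δ (z - z_s^δ)` -/
  T_dot_zdel : ∀ s : G, T (Bp 1) (zdel s) = zdel s * (zet - zdel s)
  /-- rule (I): `•̃(z) = 0` -/
  T_dot_z : T (Bp 1) (zet : Ar G) = 0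
  /-- rule (II): `B_+(f)~(z_s^δ) = R_{z-z_s^δ} R_{2z-z_s^δ} R_{z-z_s^δ}^{-1} f̃(z_s^δ)` -/
  T_graft : ∀ f : H, Coalgebra.counit (R := ℚ) f = 0 → ∀ (s : G) (u : Ar G),
      T f (zdel s) = u * (zet - zdel s) →
      T (Bp f) (zdel s) = u * ((2 : ℚ) • zet - zdel s) * (zet - zdel s)
  /-- `f̃(z_s^δ)` always ends with `z - z_s^δ` (so that rule (II) makes sense) -/
  T_ends : ∀ f : H, Coalgebra.counit (R := ℚ) f = 0 → ∀ s : G, ∃ u : Ar G,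
      T f (zdel s) = u * (zet - zdel s)
  /-- rule (II): `B_+(f)~(z) = 0` -/
  T_graft_z : ∀ f : H, T (Bp f) (zet : Ar G) = 0
  /-- rule (IV): `f̃(wv) = M(Δ(f)~(w ⊗ v))` for `v ∈ {z, z_s^δ}` -/
  T_coprod : ∀ (f : H) (w v : Ar G), (v = zet ∨ ∃ s : G, v = zdel s) →
      T f (w * v) = Tpair T w v (Coalgebra.comul (R := ℚ) f)
  /-- the polynomials `F_f ∈ A_1` -/
  F : H →ₗ[ℚ] A1
  F_one : F 1 = 1
  F_dot : F (Bp 1) = Y1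
  F_ends : ∀ f : H, Coalgebra.counit (R := ℚ) f = 0 → ∃ u : A1, F f = u * Y1
  /-- `F_{B_+(f)} = R_y R_{x+2y} R_y^{-1}(F_f)` for `f ≠ 𝟙` -/
  F_graft : ∀ f : H, Coalgebra.counit (R := ℚ) f = 0 → ∀ u : A1, F f = u * Y1 →
      F (Bp f) = u * (X1 + (2 : ℚ) • Y1) * Y1
  /-- `F_{gh} = F_g ⋄_1 F_h` -/
  F_mul : ∀ g h : H, F (g * h) = ds.D1 (F g) (F h)
  /-- the polynomials `G_f ∈ A_1` -/
  Gm : H →ₗ[ℚ] A1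
  Gm_one : Gm 1 = 1
  Gm_dot : Gm (Bp 1) = -Y1
  /-- `G_{B_+(f)} = L_{2x+y}(G_f)` for `f ≠ 𝟙` -/
  Gm_graft : ∀ f : H, Coalgebra.counit (R := ℚ) f = 0 →
      Gm (Bp f) = ((2 : ℚ) • X1 + Y1) * Gm f
  /-- `G_{gh} = G_g ⋄_1 G_h` -/
  Gm_mul : ∀ g h : H, Gm (g * h) = ds.D1 (Gm g) (Gm h)

/-- `A_1^1 = ℚ ⊕ A_1 y ⊆ A_1`. -/
noncomputable def A11 : Submodule ℚ A1 :=
  Submodule.span ℚ {1} ⊔ LinearMap.range (LinearMap.mulRight ℚ Y1)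

theorem fa_rind {α : Type} {C : FreeAlgebra ℚ α → Prop} (h1 : C 1)
    (hadd : ∀ a b, C a → C b → C (a + b)) (hsmul : ∀ (q : ℚ) a, C a → C (q • a))
    (hmul : ∀ a l, C a → C (a * ι ℚ l)) (w : FreeAlgebra ℚ α) : C w := by
  have key : ∀ w : FreeAlgebra ℚ α, ∀ a, C a → C (a * w) := by
    intro w
    induction w using FreeAlgebra.induction with
    | grade0 r =>
      intro a ha
      rw [← Algebra.commutes, ← Algebra.smul_def]
      exact hsmul _ _ ha
    | grade1 l => intro a ha; exact hmul a l ha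
    | mul u v hu hv => intro a ha; rw [← mul_assoc]; exact hv _ (hu _ ha)
    | add u v hu hv => intro a ha; rw [mul_add]; exact hadd _ _ (hu _ ha) (hv _ ha)
  simpa using key w 1 h1

theorem ar_ind_xy {C : Ar G → Prop} (h1 : C 1)
    (hadd : ∀ a b, C a → C b → C (a + b)) (hsmul : ∀ (q : ℚ) a, C a → C (q • a))
    (hx : ∀ a, C a → C (a * Xr)) (hy : ∀ a t, C a → C (a * Yr t)) (w : Ar G) : C w := by
  refine fa_rind h1 hadd hsmul ?_ w
  rintro a (_ | t) ha
  · exact hx a ha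
  · exact hy a t ha

theorem zdel_one : (zdel 1 : Ar G) = Xr := by simp [zdel]

theorem zdel_ne {t : G} (h : t ≠ 1) : (zdel t : Ar G) = Xr + Yr t := by simp [zdel, h]

/-- Induction over `A_r` using right multiplication by `z` and `z_t^δ`. -/
theorem ar_ind_z {C : Ar G → Prop} (h1 : C 1)
    (hadd : ∀ a b, C a → C b → C (a + b)) (hsmul : ∀ (q : ℚ) a, C a → C (q • a))
    (hz : ∀ a, C a → C (a * zet)) (ht : ∀ a t, C a → C (a * zdel t)) (w : Ar G) : C w := by
  have hneg : ∀ a, C a → C (-a) := fun a ha => by simpa using hsmul (-1) a ha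
  have hx : ∀ a, C a → C (a * Xr) := fun a ha => by simpa [zdel_one] using ht a 1 ha
  refine ar_ind_xy h1 hadd hsmul hx ?_ w
  intro a t ha
  by_cases h : t = 1
  · subst h
    have : a * Yr 1 = a * zet + -(a * Xr) := by rw [zet]; noncomm_ring
    rw [this]
    exact hadd _ _ (hz a ha) (hneg _ (hx a ha))
  · have : a * Yr t = a * zdel t + -(a * Xr) := by rw [zdel_ne h]; noncomm_ring
    rw [this]
    exact hadd _ _ (ht a t ha) (hneg _ (hx a ha))

/-- Induction over `A_r` using right multiplication by `z` and `z - z_t^δ`. -/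
theorem ar_ind_e {C : Ar G → Prop} (h1 : C 1)
    (hadd : ∀ a b, C a → C b → C (a + b)) (hsmul : ∀ (q : ℚ) a, C a → C (q • a))
    (hz : ∀ a, C a → C (a * zet)) (ht : ∀ a t, C a → C (a * (zet - zdel t))) (w : Ar G) : C w := by
  refine ar_ind_z h1 hadd hsmul hz ?_ w
  intro a t ha
  have : a * zdel t = a * zet + (-1 : ℚ) • (a * (zet - zdel t)) := by
    rw [mul_sub]; simp
  rw [this]
  exact hadd _ _ (hz a ha) (hsmul _ _ (ht a t ha))

/-- Induction over `A_1` using right multiplication by `x + y` and `y`. -/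
theorem a1_ind {C : A1 → Prop} (h1 : C 1)
    (hadd : ∀ a b, C a → C b → C (a + b)) (hsmul : ∀ (q : ℚ) a, C a → C (q • a))
    (hz : ∀ a, C a → C (a * (X1 + Y1))) (hy : ∀ a, C a → C (a * Y1)) (w : A1) : C w := by
  refine fa_rind h1 hadd hsmul ?_ w
  rintro a (_ | _) ha
  · have : a * ι ℚ LetA.x = a * (X1 + Y1) + (-1 : ℚ) • (a * Y1) := by
      rw [mul_add]; simp [X1]
    rw [this]
    exact hadd _ _ (hz a ha) (hsmul _ _ (hy a ha))
  · exact hy a ha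

@[simp] theorem jm_X : (jm X1 : Ar G) = Xr := by simp [jm, X1]
@[simp] theorem jm_Y : (jm Y1 : Ar G) = Yr 1 := by simp [jm, Y1]
@[simp] theorem phi_X : phi (Xr : Ar G) = zet := by simp [phi, Xr]
@[simp] theorem phi_Y (s : G) : phi (Yr s : Ar G) = zdel s - zet := by simp [phi, Yr]

theorem jm_inj : Function.Injective (jm : A1 → Ar G) := by
  let r : Ar G →ₐ[ℚ] A1 := lift ℚ (fun l => match l with
    | LetR.x => X1
    | LetR.y _ => Y1)
  have h : r.comp jm = AlgHom.id ℚ A1 := by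
    ext l
    cases l <;> simp [r, jm, Xr, Yr, X1, Y1]
  intro a b hab
  have := congrArg r hab
  have h2 := fun a => DFunLike.congr_fun h a
  simp only [AlgHom.comp_apply, AlgHom.id_apply] at h2
  rwa [h2, h2] at this

/-- `x ↦ x`, `y ↦ y_s`. -/
noncomputable def js (s : G) : A1 →ₐ[ℚ] Ar G :=
  lift ℚ (fun l => match l with
    | LetA.x => Xr
    | LetA.y => Yr s)

/-- `x ↦ x + y`, `y ↦ -y`. -/
noncomputable def phi1 : A1 →ₐ[ℚ] A1 :=
  lift ℚ (fun l => match l with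
    | LetA.x => X1 + Y1
    | LetA.y => -Y1)

@[simp] theorem js_X (s : G) : (js s X1 : Ar G) = Xr := by simp [js, X1]
@[simp] theorem js_Y (s : G) : (js s Y1 : Ar G) = Yr s := by simp [js, Y1]
@[simp] theorem phi1_X : phi1 X1 = X1 + Y1 := by rw [phi1, X1, lift_ι_apply]
@[simp] theorem phi1_Y : phi1 Y1 = -Y1 := by rw [phi1, Y1, lift_ι_apply]

/-- `x ↦ z_s^δ`, `y ↦ z - z_s^δ`. -/
noncomputable def theta (s : G) : A1 →ₐ[ℚ] Ar G := (phi.comp (js s)).comp phi1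

@[simp] theorem theta_X (s : G) : theta s X1 = zdel s := by simp [theta]
@[simp] theorem theta_Y (s : G) : theta s Y1 = zet - zdel s := by simp [theta]

theorem phi_jm (v : A1) : phi (jm v : Ar G) = jm (phi1 v) := by
  have : (phi.comp jm : A1 →ₐ[ℚ] Ar G) = jm.comp phi1 := by
    ext l
    cases l
    · change phi (jm X1 : Ar G) = jm (phi1 X1)
      simp [zet]
    · change phi (jm Y1 : Ar G) = jm (phi1 Y1)
      simp [zet, zdel_one]
  exact DFunLike.congr_fun this v

noncomputable def wd (L : List ℕ) (n : ℕ) : A1 := (L.map (fun k => X1 ^ k * Y1)).prod * X1 ^ n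

theorem wd_span (v : A1) : v ∈ Submodule.span ℚ (Set.range (fun p : List ℕ × ℕ => wd p.1 p.2)) := by
  refine fa_rind ?_ (fun a b => Submodule.add_mem _) (fun q a => Submodule.smul_mem _ q) ?_ v
  · exact Submodule.subset_span ⟨([], 0), by simp [wd]⟩
  · intro a l ha
    induction ha using Submodule.span_induction with
    | zero => simp
    | add x y _ _ hx hy => rw [add_mul]; exact Submodule.add_mem _ hx hy
    | smul q x _ hx => rw [smul_mul_assoc]; exact Submodule.smul_mem _ _ hx
    | mem x hx =>
      obtain ⟨⟨L, n⟩, rfl⟩ := hx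
      cases l
      · exact Submodule.subset_span ⟨(L, n + 1), by simp [wd, X1, pow_succ, mul_assoc]⟩
      · exact Submodule.subset_span ⟨(L ++ [n], 0), by simp [wd, Y1, mul_assoc]⟩

theorem js_wd (s : G) (L : List ℕ) (n : ℕ) :
    (js s (wd L n) : Ar G) = wordP (L.map (fun k => (k, s))) * Xr ^ n := by
  simp [wd, wordP, map_list_prod, Function.comp_def]

theorem jm_eq : (jm : A1 →ₐ[ℚ] Ar G) = js 1 := rfl

theorem cumul_map (s : G) (L : List ℕ) :
    cumul s (L.map (fun k => (k, (1 : G)))) = L.map (fun k => (k, s)) := by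
  induction L with
  | nil => rfl
  | cons a L ih => simp [cumul, ih]

namespace DiamondSetup
variable (S : DiamondSetup G)

theorem psi_jm (s : G) (v : A1) : S.psi s (jm v) = phi (js s v) := by
  have hv := wd_span v
  induction hv using Submodule.span_induction with
  | zero => simp
  | add x y _ _ hx hy => simp [hx, hy]
  | smul q x _ hx => simp [hx]
  | mem x hx =>
    obtain ⟨⟨L, n⟩, rfl⟩ := hx
    simp only [jm_eq, js_wd]
    rw [S.psi_spec, cumul_map]

theorem D_one' (s : G) (v : A1) : S.D s v 1 = theta s v := by
  rw [S.D_one, phi_jm, psi_jm]; rfl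

theorem D_zl (s : G) (v : A1) (w : Ar G) : S.D s (v * (X1 + Y1)) w = S.D s v w * zet := by
  refine ar_ind_xy (C := fun w => S.D s (v * (X1 + Y1)) w = S.D s v w * zet) ?_ ?_ ?_ ?_ ?_ w
  · simp [D_one']
  · intro a b ha hb; rw [map_add, map_add, ha, hb, add_mul]
  · intro q a ha; rw [map_smul, map_smul, ha, smul_mul_assoc]
  · intro a _
    rw [mul_add, map_add, LinearMap.add_apply, S.Dxx, S.Dyx, zet]; noncomm_ring
  · intro a t _
    rw [mul_add, map_add, LinearMap.add_apply]
    by_cases h : t = 1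
    · subst h
      rw [S.Dxy, S.Dyy, zet]; noncomm_ring
    · rw [S.Dxyt _ _ h, S.Dyyt _ _ h, zet]; noncomm_ring

theorem D_zr (s : G) (v : A1) (w : Ar G) : S.D s v (w * zet) = S.D s v w * zet := by
  refine a1_ind (C := fun v => S.D s v (w * zet) = S.D s v w * zet) ?_ ?_ ?_ ?_ ?_ v
  · simp [S.one_D]
  · intro a b ha hb; simp only [map_add, LinearMap.add_apply, ha, hb, add_mul]
  · intro q a ha; simp only [map_smul, LinearMap.smul_apply, ha, smul_mul_assoc]
  · intro a ha; rw [D_zl, D_zl, ha]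
  · intro a ha
    have h1 := S.D_zl s a w
    rw [mul_add, map_add, LinearMap.add_apply] at h1
    have h2 : S.D s (a * X1) w = S.D s a w * zet - S.D s (a * Y1) w := by rw [← h1]; abel
    have h3 : S.D s a (w * Xr) = S.D s a w * zet - S.D s a (w * Yr 1) := by
      rw [← ha, zet, mul_add, map_add]; abel
    conv_lhs => rw [zet, mul_add, map_add, S.Dyx, S.Dyy, h2, h3]
    rw [zet]; noncomm_ring

theorem D_yz (s t : G) (v : A1) (w : Ar G) : S.D s (v * Y1) (w * zdel t) =
    S.D s v (w * zdel t) * (zet - zdel t) + S.D s (v * Y1) w * zdel t := by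
  by_cases h : t = 1
  · subst h
    rw [zdel_one, S.Dyx, zet]; noncomm_ring
  · rw [zdel_ne h, mul_add, map_add, S.Dyx, S.Dyyt _ _ h, zet, mul_add, map_add]; noncomm_ring

theorem D_ye (s t : G) (v : A1) (w : Ar G) : S.D s (v * Y1) (w * (zet - zdel t)) =
    S.D s (v * Y1) w * (zet - zdel t) + S.D s v (w * (zet - zdel t)) * (zet - zdel t)
      - S.D s v w * zet * (zet - zdel t) := by
  rw [mul_sub, map_sub, map_sub, D_zr, D_zr, D_yz]; noncomm_ring

theorem jm_z : (jm (X1 + Y1) : Ar G) = zet := by simp [zet]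
theorem jm_e : (jm Y1 : Ar G) = zet - zdel 1 := by simp [zet, zdel_one]

theorem D1_one (v : A1) : S.D1 1 v = v := by
  apply jm_inj (G := G); rw [S.D1_spec, S.one_D]

theorem theta_one : (theta 1 : A1 →ₐ[ℚ] Ar G) = jm := by
  ext l
  cases l
  · change theta 1 X1 = (jm X1 : Ar G)
    simp [zdel_one]
  · change theta 1 Y1 = (jm Y1 : Ar G)
    simp [zdel_one, zet]

theorem D1_one_right (v : A1) : S.D1 v 1 = v := by
  apply jm_inj (G := G); rw [S.D1_spec, map_one, D_one', theta_one]

theorem D1_zl (u v : A1) : S.D1 (u * (X1 + Y1)) v = S.D1 u v * (X1 + Y1) := by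
  apply jm_inj (G := G); rw [S.D1_spec, D_zl, map_mul, S.D1_spec, jm_z]

theorem D1_zr (u v : A1) : S.D1 u (v * (X1 + Y1)) = S.D1 u v * (X1 + Y1) := by
  apply jm_inj (G := G); rw [S.D1_spec, map_mul jm, map_mul jm, S.D1_spec, jm_z, D_zr]

theorem D1_yy (u v : A1) : S.D1 (u * Y1) (v * Y1) =
    S.D1 (u * Y1) v * Y1 + S.D1 u (v * Y1) * Y1 - S.D1 u v * (X1 + Y1) * Y1 := by
  apply jm_inj (G := G)
  simp only [map_sub, S.D1_spec, map_mul, jm_z, map_add (jm : A1 →ₐ[ℚ] Ar G) (_ * _) (_ * _), jm_e, D_ye]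

theorem theta_z (s : G) : theta s (X1 + Y1) = zet := by simp

theorem D_theta (s : G) (u v : A1) : S.D s u (theta s v) = theta s (S.D1 u v) := by
  revert u
  refine a1_ind (C := fun v => ∀ u, S.D s u (theta s v) = theta s (S.D1 u v)) ?_ ?_ ?_ ?_ ?_ v
  · intro u; rw [map_one, D_one', D1_one_right]
  · intro a b ha hb u; simp only [map_add, ha, hb]
  · intro q a ha u; simp only [map_smul, ha]
  · intro a ha u; rw [map_mul, theta_z, D_zr, D1_zr, map_mul, theta_z, ha]
  · intro v hv u
    refine a1_ind (C := fun u => S.D s u (theta s (v * Y1)) = theta s (S.D1 u (v * Y1)))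
      ?_ ?_ ?_ ?_ ?_ u
    · rw [S.one_D, D1_one]
    · intro a b ha hb; simp only [map_add, LinearMap.add_apply, ha, hb]
    · intro q a ha; simp only [map_smul, LinearMap.smul_apply, ha]
    · intro a ha; rw [D_zl, D1_zl, ha, map_mul (theta s) _ (X1 + Y1), theta_z]
    · intro u hu
      rw [map_mul (theta s), theta_Y] at hu ⊢
      rw [D_ye, D1_yy, hv, hv, hu]
      simp only [map_sub, map_add (theta s) (_ * _) (_ * _), map_mul (theta s) _ Y1,
        map_mul (theta s) _ (X1 + Y1), theta_z, theta_Y]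

theorem assoc (s : G) (u v : A1) (w : Ar G) :
    S.D s u (S.D s v w) = S.D s (S.D1 u v) w := by
  revert u v
  refine ar_ind_e (C := fun w => ∀ u v, S.D s u (S.D s v w) = S.D s (S.D1 u v) w)
    ?_ ?_ ?_ ?_ ?_ w
  · intro u v; rw [D_one', D_one', D_theta]
  · intro a b ha hb u v; simp only [map_add, ha, hb]
  · intro q a ha u v; simp only [map_smul, ha]
  · intro a ha u v; rw [D_zr, D_zr, D_zr, ha]
  · intro w t hw u v
    revert u
    refine a1_ind (C := fun v => ∀ u, S.D s u (S.D s v (w * (zet - zdel t))) =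
      S.D s (S.D1 u v) (w * (zet - zdel t))) ?_ ?_ ?_ ?_ ?_ v
    · intro u; rw [S.one_D, D1_one_right]
    · intro a b ha hb u; simp only [map_add, LinearMap.add_apply, ha, hb]
    · intro q a ha u; simp only [map_smul, LinearMap.smul_apply, ha]
    · intro a ha u; rw [D_zl, D_zr, D1_zr, D_zl, ha]
    · intro v hv u
      refine a1_ind (C := fun u => S.D s u (S.D s (v * Y1) (w * (zet - zdel t))) =
        S.D s (S.D1 u (v * Y1)) (w * (zet - zdel t))) ?_ ?_ ?_ ?_ ?_ u
      · rw [S.one_D, D1_one]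
      · intro a b ha hb; simp only [map_add, LinearMap.add_apply, ha, hb]
      · intro q a ha; simp only [map_smul, LinearMap.smul_apply, ha]
      · intro a ha; rw [D_zl, D1_zl, D_zl, ha]
      · intro u hu
        have e1 : S.D s (v * Y1) (w * (zet - zdel t)) = (S.D s (v * Y1) w
          + S.D s v (w * (zet - zdel t)) - S.D s v w * zet) * (zet - zdel t) := by
          rw [D_ye, sub_mul, add_mul]
        have e2 : S.D1 (u * Y1) (v * Y1) = (S.D1 (u * Y1) v + S.D1 u (v * Y1)
          - S.D1 u v * (X1 + Y1)) * Y1 := by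
          rw [D1_yy, sub_mul, add_mul]
        have hu' := hu
        rw [e1] at hu'
        rw [e1, e2, D_ye, D_ye, hu', ← e2]
        simp only [map_add, map_sub, LinearMap.add_apply, LinearMap.sub_apply, D_zl, D_zr, hv, hw]
        noncomm_ring

end DiamondSetup

theorem e_ne (t : G) : (zet - zdel t : Ar G) ≠ 0 := by
  intro h
  let r : Ar G →ₐ[ℚ] ℚ := lift ℚ (fun l => by
    classical exact match l with
    | LetR.x => 0
    | LetR.y s => if s = 1 then 1 else 0)
  have hx : r Xr = 0 := by simp [r, Xr]
  have hy : r (Yr 1) = 1 := by simp [r, Yr]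
  have := congrArg r h
  by_cases ht : t = 1
  · subst ht
    simp [zdel_one, zet, hy] at this
  · have hy' : r (Yr t) = 0 := by simp [r, Yr, ht]
    simp [zdel_ne ht, zet, hx, hy, hy'] at this

theorem zdel_ne_zero (t : G) : (zdel t : Ar G) ≠ 0 := by
  intro h
  let r : Ar G →ₐ[ℚ] ℚ := lift ℚ (fun l => match l with
    | LetR.x => 1
    | LetR.y s => 0)
  have hx : r Xr = 1 := by simp [r, Xr]
  have hy : ∀ t, r (Yr t) = 0 := by simp [r, Yr]
  have := congrArg r h
  by_cases ht : t = 1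
  · subst ht
    simp [zdel_one, hx] at this
  · simp [zdel_ne ht, hx, hy] at this

namespace CKSetup
open TensorProduct Coalgebra

variable {H : Type} [CommRing H] [HopfAlgebra ℚ H] (C : CKSetup G H)

theorem counit_Bp (f : H) : counit (R := ℚ) (C.Bp f) = 0 := by
  have h := congrArg (fun t => TensorProduct.lid ℚ ℚ
    (TensorProduct.map (counit (R := ℚ)) (counit (R := ℚ)) t)) (C.Bp_cocycle f)
  have h1 : ∀ t : H ⊗[ℚ] H, TensorProduct.lid ℚ ℚ (TensorProduct.map (counit (R := ℚ))
      (counit (R := ℚ)) (TensorProduct.map LinearMap.id C.Bp t)) =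
      counit (R := ℚ) (C.Bp (TensorProduct.lid ℚ H ((counit (R := ℚ)).rTensor H t))) := by
    intro t
    induction t with
    | zero => simp
    | add x y hx hy => simp only [map_add, hx, hy]
    | tmul a b => simp
  have h2 : ∀ t : H ⊗[ℚ] H, TensorProduct.lid ℚ ℚ (TensorProduct.map (counit (R := ℚ))
      (counit (R := ℚ)) t) =
      counit (R := ℚ) (TensorProduct.lid ℚ H ((counit (R := ℚ)).rTensor H t)) := by
    intro t
    induction t with
    | zero => simp
    | add x y hx hy => simp only [map_add, hx, hy]
    | tmul a b => simp
  simp only [map_add] at h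
  rw [h1, h2, rTensor_counit_comul, rTensor_counit_comul] at h
  simpa using h

theorem T_z (f : H) : C.T f (zet : Ar G) = counit (R := ℚ) f • zet := by
  let P : Submodule ℚ H := LinearMap.eqLocus (evalT C.T (zet : Ar G))
    ((counit (R := ℚ)).smulRight (zet : Ar G))
  have hP : ∀ f, f ∈ P ↔ C.T f (zet : Ar G) = counit (R := ℚ) f • zet := fun f => Iff.rfl
  rw [← hP]
  refine C.hgen P ?_ ?_ ?_ f
  · rw [hP]; simp
  · intro a b ha hb
    rw [hP] at *
    rw [map_mul, Module.End.mul_apply, hb, map_smul, ha, Bialgebra.counit_mul, smul_smul, mul_comm]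
  · intro a _
    rw [hP, C.T_graft_z, C.counit_Bp, zero_smul]

@[simp] theorem Tpair_tmul (w v : Ar G) (a b : H) :
    Tpair C.T w v (a ⊗ₜ b) = C.T a w * C.T b v := by
  simp [Tpair, evalT]

theorem T_mul_z (f : H) (w : Ar G) : C.T f (w * zet) = C.T f w * zet := by
  rw [C.T_coprod f w zet (Or.inl rfl)]
  have h : ∀ t : H ⊗[ℚ] H, Tpair C.T w zet t =
      C.T (TensorProduct.rid ℚ H ((counit (R := ℚ)).lTensor H t)) w * zet := by
    intro t
    induction t with
    | zero => simp
    | add x y hx hy => simp only [map_add, hx, hy, LinearMap.add_apply, add_mul]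
    | tmul a b => simp [T_z]
  rw [h, lTensor_counit_comul]
  simp

/-- the subalgebra of good elements -/
noncomputable def K : Subalgebra ℚ H where
  carrier := {f | ∀ (s : G) (w : Ar G), C.T f (zdel s * w) = zdel s * C.ds.D s (C.F f) w}
  mul_mem' := by
    intro a b ha hb s w
    rw [map_mul C.T, Module.End.mul_apply, hb, ha, C.F_mul, DiamondSetup.assoc]
  add_mem' := by
    intro a b ha hb s w
    simp only [map_add, LinearMap.add_apply, mul_add, ha s w, hb s w]
  algebraMap_mem' := by
    intro q s w
    rw [Algebra.algebraMap_eq_smul_one]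
    simp [C.F_one, C.ds.one_D]

theorem mem_K (f : H) : f ∈ C.K ↔
    ∀ (s : G) (w : Ar G), C.T f (zdel s * w) = zdel s * C.ds.D s (C.F f) w := Iff.rfl

noncomputable def KH : Subalgebra ℚ (H ⊗[ℚ] H) :=
  (Algebra.TensorProduct.map C.K.val (AlgHom.id ℚ H)).range

theorem KH_ind {P : H ⊗[ℚ] H → Prop} (h0 : P 0) (hadd : ∀ a b, P a → P b → P (a + b))
    (ht : ∀ k ∈ C.K, ∀ h : H, P (k ⊗ₜ h)) (t : H ⊗[ℚ] H) (h : t ∈ C.KH) : P t := by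
  obtain ⟨x, rfl⟩ := h
  induction x with
  | zero => simpa using h0
  | add x y hx hy =>
    rw [map_add]
    exact hadd _ _ hx hy
  | tmul a b => exact ht a.1 a.2 b

noncomputable def Q : Subalgebra ℚ H := C.KH.comap (Bialgebra.comulAlgHom ℚ H)

theorem mem_Q (f : H) : f ∈ C.Q ↔ comul (R := ℚ) f ∈ C.KH := Iff.rfl

theorem Q_le (f : H) (hf : f ∈ C.Q) : f ∈ C.K := by
  rw [mem_Q] at hf
  have h : ∀ t ∈ C.KH, TensorProduct.rid ℚ H ((counit (R := ℚ)).lTensor H t) ∈ C.K := by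
    intro t ht
    refine C.KH_ind (P := fun t => TensorProduct.rid ℚ H ((counit (R := ℚ)).lTensor H t) ∈ C.K)
      ?_ ?_ ?_ t ht
    · simp
    · intro a b ha hb; rw [map_add, map_add]; exact add_mem ha hb
    · intro k hk h
      simpa using C.K.smul_mem hk _
  have := h _ hf
  rw [lTensor_counit_comul] at this
  simpa using this

theorem exists_p (t : G) : ∃ p : H →ₗ[ℚ] Ar G, ∀ f : H,
    C.T f (zdel t) = p f * (zet - zdel t) + counit (R := ℚ) f • zdel t := by
  have hinj : LinearMap.ker (LinearMap.mulRight ℚ (zet - zdel t : Ar G)) = ⊥ := by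
    rw [LinearMap.ker_eq_bot]
    exact mul_left_injective₀ (e_ne t)
  obtain ⟨r, hr⟩ := LinearMap.exists_leftInverse_of_injective _ hinj
  refine ⟨r ∘ₗ (evalT C.T (zdel t) - (counit (R := ℚ)).smulRight (zdel t : Ar G)), fun f => ?_⟩
  obtain ⟨u, hu⟩ := C.T_ends (f - counit (R := ℚ) f • 1) (by simp) t
  have hu' : C.T f (zdel t) - counit (R := ℚ) f • zdel t = u * (zet - zdel t) := by
    rw [← hu]; simp
  have h1 : r (u * (zet - zdel t)) = u := by
    simpa using DFunLike.congr_fun hr u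
  have h2 : (r ∘ₗ (evalT C.T (zdel t) - (counit (R := ℚ)).smulRight (zdel t : Ar G))) f = u := by
    conv_rhs => rw [← h1, ← hu']
    rfl
  rw [h2, ← hu']; abel

theorem T_Bp (t : G) (p : H →ₗ[ℚ] Ar G) (hp : ∀ f : H,
    C.T f (zdel t) = p f * (zet - zdel t) + counit (R := ℚ) f • zdel t) (f : H) :
    C.T (C.Bp f) (zdel t) = (p f * zet + C.T f (zdel t)) * (zet - zdel t) := by
  have h0 := C.T_graft (f - counit (R := ℚ) f • 1) (by simp) t (p f) (by
    rw [map_sub, LinearMap.sub_apply, hp]; simp)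
  rw [map_sub, map_sub, map_smul, map_smul, LinearMap.sub_apply, LinearMap.smul_apply,
    C.T_dot_zdel] at h0
  rw [sub_eq_iff_eq_add.mp h0, hp f, two_smul]
  simp only [add_mul, smul_mul_assoc]
  noncomm_ring

theorem F_form (f : H) : ∃ u : A1, C.F f = u * Y1 + counit (R := ℚ) f • 1 ∧
    C.F (C.Bp f) = u * (X1 + (2 : ℚ) • Y1) * Y1 + counit (R := ℚ) f • Y1 := by
  have hc : counit (R := ℚ) (f - counit (R := ℚ) f • 1 : H) = 0 := by simp
  obtain ⟨u, hu⟩ := C.F_ends _ hc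
  have h2 := C.F_graft _ hc u hu
  refine ⟨u, ?_, ?_⟩
  · rw [← hu]; simp [C.F_one]
  · rw [← h2]; simp [C.F_dot]

theorem Bp_mem_K (f : H) (hf : f ∈ C.Q) : C.Bp f ∈ C.K := by
  have hK := C.Q_le f hf
  rw [mem_K] at hK ⊢
  obtain ⟨u, hu, hBu⟩ := C.F_form f
  intro s w
  refine ar_ind_z (C := fun w => C.T (C.Bp f) (zdel s * w) = zdel s * C.ds.D s (C.F (C.Bp f)) w)
    ?_ ?_ ?_ ?_ ?_ w
  · obtain ⟨p, hp⟩ := C.exists_p s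
    have h1 := hK s 1
    rw [DiamondSetup.D_one', mul_one, hu] at h1
    have h3 : p f = zdel s * theta s u := by
      apply mul_left_injective₀ (e_ne s)
      have h4 := hp f
      rw [h1] at h4
      simp only [map_add, map_mul, theta_Y, map_smul, map_one, mul_add, mul_smul_comm, mul_one] at h4
      have := add_right_cancel h4
      simpa [mul_assoc] using this.symm
    rw [DiamondSetup.D_one', mul_one, C.T_Bp s p hp, h1, h3, hBu]
    simp only [map_add, map_mul, theta_Y, theta_X, map_smul, map_one, two_smul, mul_add, add_mul,
      mul_smul_comm, smul_mul_assoc, mul_one]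
    noncomm_ring
  · intro a b ha hb; simp only [mul_add, map_add, ha, hb]
  · intro q a ha; simp only [mul_smul_comm, map_smul, ha]
  · intro a ha; rw [← mul_assoc, T_mul_z, DiamondSetup.D_zr, ha, mul_assoc]
  · intro w t hw
    obtain ⟨p, hp⟩ := C.exists_p t
    let sg : H ⊗[ℚ] H →ₗ[ℚ] Ar G := TensorProduct.lift
      (((LinearMap.mul ℚ (Ar G)).compl₂ p).comp (((C.ds.D s).flip w).comp C.F))
    have Sp : ∀ a b : H, sg (a ⊗ₜ b) = C.ds.D s (C.F a) w * p b := by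
      intro a b; simp [sg]
    have s1 : ∀ x ∈ C.KH, Tpair C.T (zdel s * w) (zdel t) x = zdel s * (sg x * (zet - zdel t)
        + C.ds.D s (C.F (TensorProduct.rid ℚ H ((counit (R := ℚ)).lTensor H x))) w * zdel t) := by
      intro x hx
      refine C.KH_ind (P := fun x => Tpair C.T (zdel s * w) (zdel t) x =
        zdel s * (sg x * (zet - zdel t) + C.ds.D s (C.F (TensorProduct.rid ℚ H
          ((counit (R := ℚ)).lTensor H x))) w * zdel t)) ?_ ?_ ?_ x hx
      · simp
      · intro a b ha hb
        simp only [map_add, ha, hb, LinearMap.add_apply]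
        noncomm_ring
      · intro k hk h
        rw [Tpair_tmul, (C.mem_K k).1 hk, Sp, hp h]
        simp [mul_add, mul_assoc]
    have s2 : ∀ x ∈ C.KH, Tpair C.T (zdel s * w) (zdel t) (TensorProduct.map LinearMap.id C.Bp x) =
        (zdel s * sg x * zet + Tpair C.T (zdel s * w) (zdel t) x) * (zet - zdel t) := by
      intro x hx
      refine C.KH_ind (P := fun x => Tpair C.T (zdel s * w) (zdel t)
          (TensorProduct.map LinearMap.id C.Bp x) =
        (zdel s * sg x * zet + Tpair C.T (zdel s * w) (zdel t) x) * (zet - zdel t)) ?_ ?_ ?_ x hx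
      · simp
      · intro a b ha hb
        simp only [map_add, ha, hb]
        noncomm_ring
      · intro k hk h
        rw [TensorProduct.map_tmul, Tpair_tmul, Tpair_tmul, C.T_Bp t p hp, LinearMap.id_apply, Sp,
          (C.mem_K k).1 hk]
        simp only [mul_add, add_mul, mul_assoc]
    have hf' := (C.mem_Q f).1 hf
    have s3 := s1 _ hf'
    rw [lTensor_counit_comul, ← C.T_coprod f _ _ (Or.inr ⟨t, rfl⟩), mul_assoc, hK] at s3
    have s4 := mul_right_injective₀ (zdel_ne_zero s) s3
    have s5 : sg (comul (R := ℚ) f) = C.ds.D s u (w * zdel t) := by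
      apply mul_left_injective₀ (e_ne t)
      simp only [TensorProduct.rid_tmul, one_smul, hu, map_add, map_smul, LinearMap.add_apply,
        LinearMap.smul_apply, C.ds.one_D, DiamondSetup.D_yz, add_mul, smul_mul_assoc] at s4
      simp only
      rw [add_assoc] at s4
      exact (add_right_cancel s4).symm
    have s6 := s2 _ hf'
    rw [← C.T_coprod f _ _ (Or.inr ⟨t, rfl⟩), s5, mul_assoc (zdel s) w, hK] at s6
    have hB : C.F (C.Bp f) = (u * (X1 + Y1) + C.F f) * Y1 := by
      rw [hBu, hu, two_smul]; simp only [add_mul, smul_mul_assoc]; noncomm_ring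
    rw [← mul_assoc, C.T_coprod _ _ _ (Or.inr ⟨t, rfl⟩), C.Bp_cocycle, map_add, s6, Tpair_tmul, hw,
      map_one, Module.End.one_apply, hB, DiamondSetup.D_yz, map_add, LinearMap.add_apply,
      DiamondSetup.D_zl]
    noncomm_ring

theorem all_K (f : H) : f ∈ C.K := by
  apply C.Q_le
  refine C.hgen (Subalgebra.toSubmodule C.Q) ?_ ?_ ?_ f
  · exact one_mem C.Q
  · intro a b ha hb; exact mul_mem (S := Subalgebra ℚ H) ha hb
  · intro a ha
    have ha' : a ∈ C.Q := ha
    have hB := C.Bp_mem_K a ha'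
    change C.Bp a ∈ C.Q
    rw [mem_Q] at ha' ⊢
    rw [C.Bp_cocycle]
    have ht : ∀ k ∈ C.K, ∀ h : H, k ⊗ₜ[ℚ] h ∈ C.KH := fun k hk h =>
      ⟨(⟨k, hk⟩ : C.K) ⊗ₜ h, by simp⟩
    refine add_mem (ht _ hB _) ?_
    refine C.KH_ind (P := fun x => TensorProduct.map LinearMap.id C.Bp x ∈ C.KH) ?_ ?_ ?_ _ ha'
    · simp
    · intro a b ha hb; rw [map_add]; exact add_mem ha hb
    · intro k hk h; exact ht k hk _

theorem F_mem (f : H) : C.F f ∈ A11 := by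
  obtain ⟨u, hu, -⟩ := C.F_form f
  rw [hu, add_comm]
  refine Submodule.add_mem_sup ?_ ⟨u, rfl⟩
  exact Submodule.smul_mem _ _ (Submodule.mem_span_singleton_self 1)

end CKSetup

/-- For every `f ∈ H` there exists a unique `F_f ∈ A_1^1` such that
`f̃(z_s^δ w) = z_s^δ (F_f ⋄_s w)` for all `s ∈ μ_r`, `w ∈ A_r`; explicitly, `F_f` is
given by the recursion `F_𝟙 = 1`, `F_• = y`, `F_{B_+(g)} = R_y R_{x+2y} R_y⁻¹ (F_g)`
(`g ≠ 𝟙`), `F_{gh} = F_g ⋄_1 F_h` (the field `C.F` of the setup). -/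
theorem statement16 {G : Type} [CommGroup G] {H : Type} [CommRing H] [HopfAlgebra ℚ H]
    (C : CKSetup G H) (f : H) :
    (∃! Ff : A1, Ff ∈ A11 ∧
        ∀ (s : G) (w : Ar G), C.T f (zdel s * w) = zdel s * C.ds.D s Ff w) ∧
      C.F f ∈ A11 ∧
      ∀ (s : G) (w : Ar G), C.T f (zdel s * w) = zdel s * C.ds.D s (C.F f) w := by
  have hK := (C.mem_K f).1 (C.all_K f)
  have hF := C.F_mem f
  refine ⟨⟨C.F f, ⟨hF, hK⟩, ?_⟩, hF, hK⟩
  rintro F' ⟨-, h'⟩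
  have h1 := (h' 1 1).symm.trans (hK 1 1)
  have h2 := mul_right_injective₀ (zdel_ne_zero (1 : G)) h1
  rw [DiamondSetup.D_one', DiamondSetup.D_one', DiamondSetup.theta_one] at h2
  exact jm_inj h2
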